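/- For (θ₁,θ₂) ∈ ℝ², the point Π₂(θ₁,θ₂) ∈ ℝ³ has finite orbit under the cyclic group ⟨γ⟩ for every element γ ∈ Γ₂ if and only if θ₁ ∈ ℚ and θ₂ ∈ ℚ. -/

import Mathlib

open Real

noncomputable section

/-- `σ₁(x,y,z) = (z, y, 2yz − x)` as a bijection of `ℝ³`. -/
def sigma1 : Equiv.Perm (ℝ × ℝ × ℝ) where
  toFun p := (p.2.2, p.2.1, 2 * p.2.1 * p.2.2 - p.1)
  invFun p := (2 * p.2.1 * p.1 - p.2.2, p.2.1, p.1)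
  left_inv := by rintro ⟨x, y, z⟩; simp [Prod.ext_iff]
  right_inv := by rintro ⟨x, y, z⟩; simp [Prod.ext_iff]

/-- `σ₂(x,y,z) = (x, 2xy − z, y)` as a bijection of `ℝ³`. -/
def sigma2 : Equiv.Perm (ℝ × ℝ × ℝ) where
  toFun p := (p.1, 2 * p.1 * p.2.1 - p.2.2, p.2.1)
  invFun p := (p.1, p.2.2, 2 * p.1 * p.2.2 - p.2.1)
  left_inv := by rintro ⟨x, y, z⟩; simp [Prod.ext_iff]
  right_inv := by rintro ⟨x, y, z⟩; simp [Prod.ext_iff]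

/-- `Γ₂` is the group of bijections of `ℝ³` generated by `σ₁` and `σ₂`. -/
def Gamma2 : Subgroup (Equiv.Perm (ℝ × ℝ × ℝ)) := Subgroup.closure {sigma1, sigma2}

/-- `Π₂(θ₁,θ₂) = (cos 2πθ₁, cos 2πθ₂, cos 2π(θ₁+θ₂))`. -/
def Pi2 (θ₁ θ₂ : ℝ) : ℝ × ℝ × ℝ :=
  (Real.cos (2 * π * θ₁), Real.cos (2 * π * θ₂), Real.cos (2 * π * (θ₁ + θ₂)))

theorem sigma1_Pi2 (a b : ℝ) : sigma1 (Pi2 a b) = Pi2 (a + b) b := by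
  have h : Real.cos (2 * π * a) = Real.cos (2 * π * (a + b) - 2 * π * b) := by ring_nf
  have h' : Real.cos (2 * π * (a + b + b)) = Real.cos (2 * π * (a + b) + 2 * π * b) := by ring_nf
  simp only [sigma1, Pi2, Equiv.coe_fn_mk, Prod.mk.injEq, true_and]
  rw [h, h', Real.cos_add, Real.cos_sub]
  ring

theorem sigma2_Pi2 (a b : ℝ) : sigma2 (Pi2 a b) = Pi2 a (b - a) := by
  have h : Real.cos (2 * π * (a + b)) = Real.cos (2 * π * a + 2 * π * b) := by ring_nf
  have h' : Real.cos (2 * π * (b - a)) = Real.cos (2 * π * b - 2 * π * a) := by ring_nf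
  have h'' : a + (b - a) = b := by ring
  simp only [sigma2, Pi2, Equiv.coe_fn_mk, Prod.mk.injEq, true_and, h'', and_true]
  rw [h, h', Real.cos_add, Real.cos_sub]
  ring

theorem sigma1_pow (a b : ℝ) (k : ℕ) : (sigma1 ^ k) (Pi2 a b) = Pi2 (a + k * b) b := by
  induction k with
  | zero => simp
  | succ n ih =>
    rw [pow_succ', Equiv.Perm.mul_apply, ih, sigma1_Pi2]
    congr 1
    push_cast; ring

theorem sigma2_pow (a b : ℝ) (k : ℕ) : (sigma2 ^ k) (Pi2 a b) = Pi2 a (b + k * (-a)) := by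
  induction k with
  | zero => simp
  | succ n ih =>
    rw [pow_succ', Equiv.Perm.mul_apply, ih, sigma2_Pi2]
    congr 1
    push_cast; ring

theorem rat_of_finite (a b : ℝ)
    (h : (Set.range fun k : ℕ => Real.cos (2 * π * (a + k * b))).Finite) :
    ∃ q : ℚ, b = q := by
  classical
  let F : ℕ → ℝ × Prop := fun k =>
    (Real.cos (2 * π * (a + k * b)), 0 ≤ Real.sin (2 * π * (a + k * b)))
  have hF : (Set.range F).Finite := by
    refine (h.prod (Set.finite_univ (α := Prop))).subset ?_
    rintro _ ⟨k, rfl⟩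
    exact ⟨⟨k, rfl⟩, trivial⟩
  have hni : ¬ Function.Injective F := fun hi => Set.infinite_range_of_injective hi hF
  simp only [Function.Injective, not_forall] at hni
  obtain ⟨j, k, hjk, hne⟩ := hni
  simp only [F, Prod.mk.injEq, eq_iff_iff] at hjk
  obtain ⟨hc, hs⟩ := hjk
  have hs' : Real.sin (2 * π * (a + j * b)) = Real.sin (2 * π * (a + k * b)) := by
    have h1 := Real.sin_sq_add_cos_sq (2 * π * (a + j * b))
    have h2 := Real.sin_sq_add_cos_sq (2 * π * (a + k * b))
    rw [hc] at h1
    rcases sq_eq_sq_iff_eq_or_eq_neg.1 (show Real.sin (2 * π * (a + j * b)) ^ 2 =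
      Real.sin (2 * π * (a + k * b)) ^ 2 by linarith) with h3 | h3
    · exact h3
    · by_cases h4 : 0 ≤ Real.sin (2 * π * (a + j * b))
      · have := hs.1 h4
        linarith
      · have h5 : ¬ 0 ≤ Real.sin (2 * π * (a + k * b)) := fun h => h4 (hs.2 h)
        rw [not_le] at h4 h5
        linarith
  have hA := Real.Angle.cos_sin_inj hc hs'
  rw [Real.Angle.angle_eq_iff_two_pi_dvd_sub] at hA
  obtain ⟨n, hn⟩ := hA
  have h6 : ((j : ℝ) - k) * b = n := by
    have : 2 * π * (((j : ℝ) - k) * b) = 2 * π * n := by linarith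
    exact mul_left_cancel₀ (by positivity) this
  have h7 : (j : ℝ) - k ≠ 0 := by
    intro h; apply hne; exact_mod_cast sub_eq_zero.1 h
  refine ⟨n / ((j : ℚ) - k), ?_⟩
  push_cast
  rw [eq_div_iff h7]
  linarith

/-- Points whose angles have denominator dividing `N`. -/
def torsSet (N : ℕ) : Set (ℝ × ℝ × ℝ) :=
  Set.range fun p : ℤ × ℤ => Pi2 (p.1 / N) (p.2 / N)

theorem cos_mod (N : ℕ) (hN : 0 < N) (m : ℤ) :
    Real.cos (2 * π * (m / N)) = Real.cos (2 * π * ((m % N : ℤ) / N)) := by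
  have hN' : (N : ℝ) ≠ 0 := by positivity
  have h : (m : ℝ) = (m % N : ℤ) + N * (m / N : ℤ) := by
    exact_mod_cast (Int.emod_add_mul_ediv m N).symm
  have h2 : 2 * π * ((m : ℝ) / N) = 2 * π * ((m % N : ℤ) / N) + (m / N : ℤ) * (2 * π) := by
    rw [h]
    field_simp
  rw [h2, Real.cos_add_int_mul_two_pi]

theorem torsSet_finite (N : ℕ) (hN : 0 < N) : (torsSet N).Finite := by
  have hC : (Set.range fun m : ℤ => Real.cos (2 * π * (m / N))).Finite := by
    refine ((Set.finite_Ico (0 : ℤ) N).image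
      fun m : ℤ => Real.cos (2 * π * (m / N))).subset ?_
    rintro _ ⟨m, rfl⟩
    refine ⟨m % N, ⟨Int.emod_nonneg _ (by omega), Int.emod_lt_of_pos _ (by omega)⟩, ?_⟩
    exact (cos_mod N hN m).symm
  refine (hC.prod (hC.prod hC)).subset ?_
  rintro _ ⟨⟨m, n⟩, rfl⟩
  refine ⟨⟨m, rfl⟩, ⟨n, rfl⟩, ⟨m + n, ?_⟩⟩
  simp only [Pi2]
  push_cast
  rw [add_div]

theorem Gamma2_torsSet (N : ℕ) (γ : Equiv.Perm (ℝ × ℝ × ℝ)) (hγ : γ ∈ Gamma2) :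
    ∀ p, p ∈ torsSet N ↔ γ p ∈ torsSet N := by
  induction hγ using Subgroup.closure_induction with
  | mem x hx =>
    intro p
    rcases hx with rfl | rfl
    · constructor
      · rintro ⟨⟨m, n⟩, rfl⟩
        refine ⟨(m + n, n), ?_⟩
        simp only [sigma1_Pi2]
        push_cast
        rw [add_div]
      · rintro ⟨⟨m, n⟩, h⟩
        refine ⟨(m - n, n), sigma1.injective ?_⟩
        rw [← h, sigma1_Pi2]
        push_cast
        congr 1
        ring
    · constructor
      · rintro ⟨⟨m, n⟩, rfl⟩
        refine ⟨(m, n - m), ?_⟩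
        simp only [sigma2_Pi2]
        push_cast
        rw [sub_div]
      · rintro ⟨⟨m, n⟩, h⟩
        refine ⟨(m, n + m), sigma2.injective ?_⟩
        rw [← h, sigma2_Pi2]
        push_cast
        congr 1
        ring
  | one => simp
  | mul x y _ _ hx hy => intro p; rw [Equiv.Perm.mul_apply, ← hx, ← hy]
  | inv x _ hx => intro p; rw [hx (x⁻¹ p), ← Equiv.Perm.mul_apply, mul_inv_cancel, Equiv.Perm.one_apply]

theorem stmt2 (θ₁ θ₂ : ℝ) :
    (∀ γ ∈ Gamma2, (Set.range fun k : ℤ => (γ ^ k) (Pi2 θ₁ θ₂)).Finite) ↔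
      ((∃ q : ℚ, θ₁ = q) ∧ (∃ q : ℚ, θ₂ = q)) := by
  constructor
  · intro h
    constructor
    · have h2 := h sigma2 (Subgroup.subset_closure (by simp))
      obtain ⟨q, hq⟩ := rat_of_finite θ₂ (-θ₁) (by
        refine (h2.image fun p => p.2.1).subset ?_
        rintro _ ⟨k, rfl⟩
        refine ⟨_, ⟨(k : ℤ), rfl⟩, ?_⟩
        simp only [zpow_natCast, sigma2_pow]
        rfl)
      exact ⟨-q, by push_cast; linarith⟩
    · have h1 := h sigma1 (Subgroup.subset_closure (by simp))
      apply rat_of_finite θ₁ θ₂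
      refine (h1.image fun p => p.1).subset ?_
      rintro _ ⟨k, rfl⟩
      refine ⟨_, ⟨(k : ℤ), rfl⟩, ?_⟩
      simp only [zpow_natCast, sigma1_pow]
      rfl
  · rintro ⟨⟨q, rfl⟩, ⟨r, rfl⟩⟩ γ hγ
    refine (torsSet_finite (q.den * r.den) (Nat.mul_pos q.den_pos r.den_pos)).subset ?_
    rintro _ ⟨k, rfl⟩
    refine (Gamma2_torsSet _ _ (Subgroup.zpow_mem _ hγ k) _).1 ⟨(q.num * r.den, r.num * q.den), ?_⟩
    have hq : (q.den : ℝ) ≠ 0 := by exact_mod_cast q.den_ne_zero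
    have hr : (r.den : ℝ) ≠ 0 := by exact_mod_cast r.den_ne_zero
    have e1 : (q : ℝ) = q.num / q.den := Rat.cast_def q
    have e2 : (r : ℝ) = r.num / r.den := Rat.cast_def r
    rw [e1, e2]
    push_cast
    congr 1 <;> field_simp

end
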